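/- Assume M′ := sup_{t ∈ [0,∞)} |f′(t)| < ∞ and M″ := sup_{t ∈ (0,∞)} |t · f″(t)| < ∞. Let z : U →L[ℝ] H be a continuous linear map with ‖z‖²_HS := ∑'_j ‖z ẽ_j‖² < ∞. Then for every integer n ≥ 1 and every x ∈ H the family ( (D²Π^n)(x)(z ẽ_j, z ẽ_j) )_{j∈κ} is summable in H and ‖ ∑'_j (D²Π^n)(x)(z ẽ_j, z ẽ_j) ‖ ≤ (3M′ + 2M″) · ‖x‖ · ‖z‖²_HS. -/

import Mathlib

/-- The taming map `Π^n(x) = f(½‖x‖² n^{-2γ}) • x`. -/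
noncomputable def tamingMap {H : Type*} [NormedAddCommGroup H] [InnerProductSpace ℝ H]
    (f : ℝ → ℝ) (γ : ℝ) (n : ℕ) (x : H) : H :=
  f (2⁻¹ * ‖x‖ ^ 2 * (n : ℝ) ^ (-(2 * γ))) • x

section TamingMap

open scoped RealInnerProductSpace

variable {H : Type*} [NormedAddCommGroup H] [InnerProductSpace ℝ H]

theorem hasFDerivAt_half_norm_sq_mul (c : ℝ) (x : H) :
    HasFDerivAt (fun y : H => 2⁻¹ * ‖y‖ ^ 2 * c) (c • innerSL ℝ x) x := by
  have h := (((hasStrictFDerivAt_norm_sq x).hasFDerivAt).const_mul (2⁻¹ : ℝ)).mul_const c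
  refine h.congr_fderiv ?_
  ext u
  simp

theorem hasFDerivAt_comp_half_norm_sq_mul {g : ℝ → ℝ} (hg : Differentiable ℝ g) (c : ℝ) (x : H) :
    HasFDerivAt (fun y : H => g (2⁻¹ * ‖y‖ ^ 2 * c))
      (deriv g (2⁻¹ * ‖x‖ ^ 2 * c) • c • innerSL ℝ x) x :=
  (hg _).hasDerivAt.comp_hasFDerivAt x (hasFDerivAt_half_norm_sq_mul c x)

theorem fderiv_tamingMap_apply {f : ℝ → ℝ} (hf : Differentiable ℝ f) (γ : ℝ) (n : ℕ) (x u : H) :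
    fderiv ℝ (tamingMap (H := H) f γ n) x u =
      f (2⁻¹ * ‖x‖ ^ 2 * (n : ℝ) ^ (-(2 * γ))) • u +
        (deriv f (2⁻¹ * ‖x‖ ^ 2 * (n : ℝ) ^ (-(2 * γ))) * ((n : ℝ) ^ (-(2 * γ)) * ⟪x, u⟫)) • x := by
  have h := (hasFDerivAt_comp_half_norm_sq_mul hf ((n : ℝ) ^ (-(2 * γ))) x).smul (hasFDerivAt_id x)
  have h' : HasFDerivAt (tamingMap (H := H) f γ n) _ x := h
  rw [h'.fderiv]
  simp

theorem contDiff_tamingMap {k : WithTop ℕ∞} {f : ℝ → ℝ} (hf : ContDiff ℝ k f) (γ : ℝ) (n : ℕ) :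
    ContDiff ℝ k (tamingMap (H := H) f γ n) :=
  (hf.comp ((contDiff_const.mul (contDiff_norm_sq ℝ)).mul contDiff_const)).smul contDiff_id

theorem fderiv_fderiv_tamingMap_apply {f : ℝ → ℝ} (hf : ContDiff ℝ 2 f) (γ : ℝ) (n : ℕ)
    (x v u : H) {c t : ℝ} (hc : c = (n : ℝ) ^ (-(2 * γ))) (ht : t = 2⁻¹ * ‖x‖ ^ 2 * c) :
    fderiv ℝ (fderiv ℝ (tamingMap (H := H) f γ n)) x v u =
      (deriv f t * (c * ⟪x, v⟫)) • u + (deriv f t * (c * ⟪x, u⟫)) • v +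
        (deriv f t * (c * ⟪v, u⟫)) • x +
          (deriv (deriv f) t * (c * ⟪x, v⟫) * (c * ⟪x, u⟫)) • x := by
  have hf1 : Differentiable ℝ f := hf.differentiable two_ne_zero
  have hf2 : Differentiable ℝ (deriv f) :=
    (contDiff_succ_iff_deriv.1 (one_add_one_eq_two (R := WithTop ℕ∞) ▸ hf)).2.2.differentiable
      one_ne_zero
  have hd : DifferentiableAt ℝ (fderiv ℝ (tamingMap (H := H) f γ n)) x :=
    ((contDiff_tamingMap hf γ n).fderiv_right (m := 1) one_add_one_eq_two.le).differentiable
      one_ne_zero x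
  have h1 := hd.hasFDerivAt.clm_apply (hasFDerivAt_const u x)
  have hin : HasFDerivAt (fun y : H => c * ⟪y, u⟫) (c • innerSL ℝ u) x := by
    have := ((innerSL ℝ u).hasFDerivAt (x := x)).const_mul c
    simpa [real_inner_comm] using this
  have h2 := ((hasFDerivAt_comp_half_norm_sq_mul hf1 c x).smul_const u).add
    (((hasFDerivAt_comp_half_norm_sq_mul hf2 c x).mul hin).smul (hasFDerivAt_id x))
  have heq : (fun y : H => fderiv ℝ (tamingMap (H := H) f γ n) y u) = _ :=
    funext fun y => fderiv_tamingMap_apply hf1 γ n y u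
  rw [heq, ← hc] at h1
  have h3 := congrArg (fun L : H →L[ℝ] H => L v) (h1.unique h2)
  simp [real_inner_comm] at h3
  rw [h3, ← ht]
  module

theorem norm_fderiv_fderiv_tamingMap_apply_self_le {f : ℝ → ℝ} (hf : ContDiff ℝ 2 f)
    {γ : ℝ} (hγ : 0 ≤ γ) {n : ℕ} (hn : 1 ≤ n) {A B : ℝ}
    (hA : ∀ t, 0 ≤ t → |deriv f t| ≤ A) (hB : ∀ t, 0 < t → |t * deriv (deriv f) t| ≤ B)
    (x u : H) :
    ‖fderiv ℝ (fderiv ℝ (tamingMap (H := H) f γ n)) x u u‖ ≤ (3 * A + 2 * B) * ‖x‖ * ‖u‖ ^ 2 := by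
  obtain ⟨c, hc⟩ : ∃ c : ℝ, c = (n : ℝ) ^ (-(2 * γ)) := ⟨_, rfl⟩
  obtain ⟨t, ht⟩ : ∃ t : ℝ, t = 2⁻¹ * ‖x‖ ^ 2 * c := ⟨_, rfl⟩
  have hn' : (1 : ℝ) ≤ n := by exact_mod_cast hn
  have hc0 : 0 < c := hc ▸ Real.rpow_pos_of_pos (by linarith) _
  have hc1 : c ≤ 1 := hc ▸ Real.rpow_le_one_of_one_le_of_nonpos hn' (by linarith)
  rw [fderiv_fderiv_tamingMap_apply hf γ n x u u hc ht]
  rcases eq_or_ne x 0 with rfl | hx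
  · simp
  have ht0 : 0 < t := by rw [ht]; have := norm_pos_iff.2 hx; positivity
  have hAt := hA t ht0.le
  have hBt := hB t ht0
  rw [abs_mul, abs_of_pos ht0] at hBt
  have hA0 : 0 ≤ A := (abs_nonneg _).trans hAt
  have hB0 : 0 ≤ B := (by positivity : (0 : ℝ) ≤ _).trans hBt
  have hxu : |⟪x, u⟫| ≤ ‖x‖ * ‖u‖ := abs_real_inner_le_norm x u
  have e1 : ‖(deriv f t * (c * ⟪x, u⟫)) • u‖ ≤ A * ‖x‖ * ‖u‖ ^ 2 := by
    rw [norm_smul, Real.norm_eq_abs, abs_mul, abs_mul, abs_of_pos hc0]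
    calc |deriv f t| * (c * |⟪x, u⟫|) * ‖u‖ ≤ A * (1 * (‖x‖ * ‖u‖)) * ‖u‖ := by gcongr
      _ = _ := by ring
  have e2 : ‖(deriv f t * (c * ⟪u, u⟫)) • x‖ ≤ A * ‖x‖ * ‖u‖ ^ 2 := by
    rw [norm_smul, Real.norm_eq_abs, abs_mul, abs_mul, abs_of_pos hc0,
      real_inner_self_eq_norm_sq, abs_of_nonneg (sq_nonneg ‖u‖)]
    calc |deriv f t| * (c * ‖u‖ ^ 2) * ‖x‖ ≤ A * (1 * ‖u‖ ^ 2) * ‖x‖ := by gcongr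
      _ = _ := by ring
  have e3 : ‖(deriv (deriv f) t * (c * ⟪x, u⟫) * (c * ⟪x, u⟫)) • x‖
      ≤ 2 * B * ‖x‖ * ‖u‖ ^ 2 := by
    rw [norm_smul, Real.norm_eq_abs, abs_mul, abs_mul, abs_mul, abs_of_pos hc0]
    calc |deriv (deriv f) t| * (c * |⟪x, u⟫|) * (c * |⟪x, u⟫|) * ‖x‖
        ≤ |deriv (deriv f) t| * (c * (‖x‖ * ‖u‖)) * (c * (‖x‖ * ‖u‖)) * ‖x‖ := by gcongr
      _ = (t * |deriv (deriv f) t|) * (2 * c * ‖x‖ * ‖u‖ ^ 2) := by rw [ht]; ring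
      _ ≤ B * (2 * 1 * ‖x‖ * ‖u‖ ^ 2) := by gcongr
      _ = _ := by ring
  refine (norm_add₄_le).trans ?_
  linarith

end TamingMap

/-- With `M' = sup_{t ≥ 0} |f'(t)|` and `M'' = sup_{t > 0} |t f''(t)|`, for any
Hilbert–Schmidt `z : U →L[ℝ] H` the family `((D²Π^n)(x)(z ẽ_j, z ẽ_j))_j` is summable and
`‖∑'_j (D²Π^n)(x)(z ẽ_j, z ẽ_j)‖ ≤ (3M' + 2M'') ‖x‖ ‖z‖²_HS`. -/
theorem tamingMap_second_fderiv_trace_bound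
    {H : Type*} [NormedAddCommGroup H] [InnerProductSpace ℝ H] [CompleteSpace H]
    {U : Type*} [NormedAddCommGroup U] [InnerProductSpace ℝ U] [CompleteSpace U]
    {κ : Type*} [Countable κ] (ebar : HilbertBasis κ ℝ U)
    (f : ℝ → ℝ) (hf : ContDiff ℝ 2 f) (γ : ℝ) (hγ : 0 ≤ γ)
    (hM' : BddAbove ((fun t => |deriv f t|) '' Set.Ici (0 : ℝ)))
    (hM'' : BddAbove ((fun t => |t * deriv (deriv f) t|) '' Set.Ioi (0 : ℝ)))
    (z : U →L[ℝ] H) (hz : Summable fun j => ‖z (ebar j)‖ ^ 2)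
    (n : ℕ) (hn : 1 ≤ n) (x : H) :
    (Summable fun j =>
        fderiv ℝ (fderiv ℝ (tamingMap (H := H) f γ n)) x (z (ebar j)) (z (ebar j))) ∧
      ‖∑' j, fderiv ℝ (fderiv ℝ (tamingMap (H := H) f γ n)) x (z (ebar j)) (z (ebar j))‖
        ≤ (3 * sSup ((fun t => |deriv f t|) '' Set.Ici (0 : ℝ))
            + 2 * sSup ((fun t => |t * deriv (deriv f) t|) '' Set.Ioi (0 : ℝ)))
          * ‖x‖ * ∑' j, ‖z (ebar j)‖ ^ 2 := by
  have hle : ∀ j, ‖fderiv ℝ (fderiv ℝ (tamingMap (H := H) f γ n)) x (z (ebar j)) (z (ebar j))‖ ≤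
      (3 * sSup ((fun t => |deriv f t|) '' Set.Ici (0 : ℝ))
        + 2 * sSup ((fun t => |t * deriv (deriv f) t|) '' Set.Ioi (0 : ℝ)))
        * ‖x‖ * ‖z (ebar j)‖ ^ 2 := fun j =>
    norm_fderiv_fderiv_tamingMap_apply_self_le hf hγ hn
      (fun t ht => le_csSup hM' (Set.mem_image_of_mem _ ht))
      (fun t ht => le_csSup hM'' (Set.mem_image_of_mem _ ht)) x (z (ebar j))
  exact ⟨(hz.mul_left _).of_norm_bounded hle, tsum_of_norm_bounded (hz.hasSum.mul_left _) hle⟩
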